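/- Let A and B be DG Poisson algebras over a field k with Poisson brackets of the same degree p. Suppose (C, f, g) is a triple with property P with respect to A and (D, j, k) is a triple with property P with respect to B. Then the triple (C ⊗ D, f ⊗ j, f ⊗ k + (−1)^{p|B|} g ⊗ j) has property P with respect to the tensor product DG Poisson algebra A ⊗ B, where C ⊗ D is the graded tensor product DG algebra, (f⊗j)(a⊗b) = f(a)⊗j(b), and (f ⊗ k + (−1)^{p|B|} g ⊗ j)(a⊗b) := f(a)⊗k(b) + (−1)^{p|b|} g(a)⊗j(b) for homogeneous a ∈ A, b ∈ B. -/

import Mathlib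

open scoped TensorProduct

noncomputable section

/-- A (graded-commutative) DG Poisson algebra structure, with Poisson bracket of degree `p`,
on a `ℤ`-graded `k`-algebra `A` with grading `𝒜`, differential `dA` and bracket `br`.
All axioms are stated for homogeneous elements, and signs are the Koszul signs. -/
structure IsDGPoissonAlgebra (k : Type) [Field k] (A : Type) [Ring A] [Algebra k A]
    (𝒜 : ℤ → Submodule k A) (dA : A →ₗ[k] A)
    (br : A →ₗ[k] A →ₗ[k] A) (p : ℤ) : Prop where
  comm : ∀ (i j : ℤ) (a b : A), a ∈ 𝒜 i → b ∈ 𝒜 j →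
    a * b = ((-1 : k) ^ (i * j)) • (b * a)
  d_mem : ∀ (i : ℤ) (a : A), a ∈ 𝒜 i → dA a ∈ 𝒜 (i + 1)
  d_sq : ∀ a : A, dA (dA a) = 0
  d_mul : ∀ (i j : ℤ) (a b : A), a ∈ 𝒜 i → b ∈ 𝒜 j →
    dA (a * b) = dA a * b + ((-1 : k) ^ i) • (a * dA b)
  br_mem : ∀ (i j : ℤ) (a b : A), a ∈ 𝒜 i → b ∈ 𝒜 j → br a b ∈ 𝒜 (i + j + p)
  antisymm : ∀ (i j : ℤ) (a b : A), a ∈ 𝒜 i → b ∈ 𝒜 j →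
    br a b = -(((-1 : k) ^ ((i + p) * (j + p))) • br b a)
  jacobi : ∀ (i j l : ℤ) (a b c : A), a ∈ 𝒜 i → b ∈ 𝒜 j → c ∈ 𝒜 l →
    br a (br b c) = br (br a b) c + ((-1 : k) ^ ((i + p) * (j + p))) • br b (br a c)
  d_br : ∀ (i j : ℤ) (a b : A), a ∈ 𝒜 i → b ∈ 𝒜 j →
    dA (br a b) = br (dA a) b + ((-1 : k) ^ (i + p)) • br a (dA b)
  poisson : ∀ (i j l : ℤ) (a b c : A), a ∈ 𝒜 i → b ∈ 𝒜 j → c ∈ 𝒜 l →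
    br a (b * c) = br a b * c + ((-1 : k) ^ ((i + p) * j)) • (b * br a c)

/-- A (not necessarily commutative) DG algebra structure on a `ℤ`-graded `k`-algebra. -/
structure IsDGAlgebra (k : Type) [Field k] (B : Type) [Ring B] [Algebra k B]
    (ℬ : ℤ → Submodule k B) (dB : B →ₗ[k] B) : Prop where
  graded_monoid : SetLike.GradedMonoid ℬ
  decomp : Nonempty (DirectSum.Decomposition ℬ)
  d_mem : ∀ (i : ℤ) (x : B), x ∈ ℬ i → dB x ∈ ℬ (i + 1)
  d_sq : ∀ x : B, dB (dB x) = 0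
  d_mul : ∀ (i j : ℤ) (x y : B), x ∈ ℬ i → y ∈ ℬ j →
    dB (x * y) = dB x * y + ((-1 : k) ^ i) • (x * dB y)
/-- Property `𝒫` for a triple `(B, f, g)` with respect to a DG Poisson algebra `A` with
bracket of degree `p`:  `f` is a degree-0 DG-algebra map, `g` is a degree-`p` DG Lie algebra
map into `B` with the graded-commutator bracket, and the mixed conditions (P3), (P4) hold. -/
structure IsPTriple (k : Type) [Field k] (A : Type) [Ring A] [Algebra k A]
    (B : Type) [Ring B] [Algebra k B]
    (𝒜 : ℤ → Submodule k A) (dA : A →ₗ[k] A) (br : A →ₗ[k] A →ₗ[k] A) (p : ℤ)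
    (ℬ : ℤ → Submodule k B) (dB : B →ₗ[k] B)
    (f g : A →ₗ[k] B) : Prop where
  f_one : f 1 = 1
  f_mul : ∀ a b : A, f (a * b) = f a * f b
  f_mem : ∀ (i : ℤ) (a : A), a ∈ 𝒜 i → f a ∈ ℬ i
  f_d : ∀ a : A, f (dA a) = dB (f a)
  g_mem : ∀ (i : ℤ) (a : A), a ∈ 𝒜 i → g a ∈ ℬ (i + p)
  g_d : ∀ a : A, g (dA a) = dB (g a)
  g_br : ∀ (i j : ℤ) (a b : A), a ∈ 𝒜 i → b ∈ 𝒜 j →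
    g (br a b) = g a * g b - ((-1 : k) ^ ((i + p) * (j + p))) • (g b * g a)
  f_br : ∀ (i j : ℤ) (a b : A), a ∈ 𝒜 i → b ∈ 𝒜 j →
    f (br a b) = g a * f b - ((-1 : k) ^ ((i + p) * j)) • (f b * g a)
  g_mul : ∀ (i j : ℤ) (a b : A), a ∈ 𝒜 i → b ∈ 𝒜 j →
    g (a * b) = f a * g b + ((-1 : k) ^ (i * j)) • (f b * g a)
/-- `W`, together with the bilinear map `μ : M → N → W` (thought of as `m ⊗ n`), realizes the
tensor product of the graded vector spaces `M` and `N`: `μ` induces a linear bijection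
`M ⊗[k] N ≃ W`, homogeneous tensors are homogeneous of the expected total degree, and every
homogeneous element of `W` is a sum of homogeneous tensors of that total degree. -/
structure RealizesGradedTensor (k : Type) [Field k]
    (M : Type) [AddCommGroup M] [Module k M]
    (N : Type) [AddCommGroup N] [Module k N]
    (W : Type) [AddCommGroup W] [Module k W]
    (𝒱M : ℤ → Submodule k M) (𝒱N : ℤ → Submodule k N) (𝒲 : ℤ → Submodule k W)
    (μ : M →ₗ[k] N →ₗ[k] W) : Prop where
  bij : Function.Bijective (TensorProduct.lift μ)
  mem : ∀ (i j : ℤ) (m : M) (n : N), m ∈ 𝒱M i → n ∈ 𝒱N j → μ m n ∈ 𝒲 (i + j)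
  span : ∀ nn : ℤ, (𝒲 nn : Set W) ⊆
    (Submodule.span k {w : W | ∃ (i j : ℤ) (m : M) (n : N),
      i + j = nn ∧ m ∈ 𝒱M i ∧ n ∈ 𝒱N j ∧ μ m n = w} : Submodule k W)

/-- `C`, together with the bilinear map `μ : A → B → C` (thought of as `a ⊗ b`), realizes the
graded tensor product of the graded algebras `A` and `B`, with the Koszul-sign multiplication
`(a₁ ⊗ b₁)(a₂ ⊗ b₂) = (-1)^{|a₂||b₁|} (a₁a₂) ⊗ (b₁b₂)` and unit `1 ⊗ 1`. -/
structure RealizesGradedTensorAlg (k : Type) [Field k]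
    (A : Type) [Ring A] [Algebra k A] (B : Type) [Ring B] [Algebra k B]
    (C : Type) [Ring C] [Algebra k C]
    (𝒜 : ℤ → Submodule k A) (ℬ : ℤ → Submodule k B) (𝒞 : ℤ → Submodule k C)
    (μ : A →ₗ[k] B →ₗ[k] C) : Prop where
  toRealizesGradedTensor : RealizesGradedTensor k A B C 𝒜 ℬ 𝒞 μ
  one : μ 1 1 = 1
  mul : ∀ (i₁ j₁ i₂ j₂ : ℤ) (a₁ a₂ : A) (b₁ b₂ : B),
    a₁ ∈ 𝒜 i₁ → b₁ ∈ ℬ j₁ → a₂ ∈ 𝒜 i₂ → b₂ ∈ ℬ j₂ →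
    μ a₁ b₁ * μ a₂ b₂ = ((-1 : k) ^ (i₂ * j₁)) • μ (a₁ * a₂) (b₁ * b₂)

section KoszulSigns

variable {k : Type} [Field k]

lemma neg_one_zpow_mul_self (n : ℤ) : (-1 : k) ^ n * (-1 : k) ^ n = 1 := by
  rw [← mul_zpow]; simp

lemma neg_one_zpow_self_mul (n : ℤ) : (-1 : k) ^ (n * n) = (-1 : k) ^ n := by
  rcases Int.even_or_odd n with h | h
  · rw [h.neg_one_zpow, (h.mul_left n).neg_one_zpow]
  · rw [h.neg_one_zpow, (h.mul h).neg_one_zpow]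

lemma neg_one_zpow_add (m n : ℤ) : (-1 : k) ^ (m + n) = (-1 : k) ^ m * (-1 : k) ^ n :=
  zpow_add₀ (neg_ne_zero.2 one_ne_zero) m n

/-- The sign twist `b ↦ (-1)^{p|b|} b` of a graded algebra. -/
def gradedSign {B : Type} [Ring B] [Algebra k B] (ℬ : ℤ → Submodule k B) [GradedAlgebra ℬ]
    (p : ℤ) : B →ₗ[k] B :=
  DirectSum.toModule k ℤ B (fun j => ((-1 : k) ^ (p * j)) • (ℬ j).subtype) ∘ₗ
    (DirectSum.decomposeLinearEquiv ℬ).toLinearMap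

lemma gradedSign_of_mem {B : Type} [Ring B] [Algebra k B] (ℬ : ℤ → Submodule k B)
    [GradedAlgebra ℬ] (p : ℤ) {j : ℤ} {b : B} (hb : b ∈ ℬ j) :
    gradedSign ℬ p b = ((-1 : k) ^ (p * j)) • b := by
  simp only [gradedSign, LinearMap.comp_apply, LinearEquiv.coe_coe,
    DirectSum.decomposeLinearEquiv_apply]
  rw [DirectSum.decompose_of_mem ℬ hb, ← DirectSum.lof_eq_of k, DirectSum.toModule_lof]
  simp

end KoszulSigns

namespace RealizesGradedTensor

variable {k : Type} [Field k]
  {M : Type} [AddCommGroup M] [Module k M]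
  {N : Type} [AddCommGroup N] [Module k N]
  {W : Type} [AddCommGroup W] [Module k W]
  {V : Type} [AddCommGroup V] [Module k V]
  {𝒱M : ℤ → Submodule k M} {𝒱N : ℤ → Submodule k N} {𝒲 : ℤ → Submodule k W}
  {μ : M →ₗ[k] N →ₗ[k] W}

/-- The linear map `W → V` induced by a bilinear map `M → N → V`. -/
def desc (h : RealizesGradedTensor k M N W 𝒱M 𝒱N 𝒲 μ) (φ : M →ₗ[k] N →ₗ[k] V) : W →ₗ[k] V :=
  TensorProduct.lift φ ∘ₗ (LinearEquiv.ofBijective _ h.bij).symm.toLinearMap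

lemma desc_apply (h : RealizesGradedTensor k M N W 𝒱M 𝒱N 𝒲 μ) (φ : M →ₗ[k] N →ₗ[k] V)
    (m : M) (n : N) : h.desc φ (μ m n) = φ m n := by
  have : (LinearEquiv.ofBijective _ h.bij).symm (μ m n) = m ⊗ₜ[k] n := by
    rw [LinearEquiv.symm_apply_eq]; simp
  simp [desc, this]

lemma mem_of_forall (h : RealizesGradedTensor k M N W 𝒱M 𝒱N 𝒲 μ) (φ : W →ₗ[k] V)
    (S : Submodule k V) {r : ℤ}
    (H : ∀ i j m n, i + j = r → m ∈ 𝒱M i → n ∈ 𝒱N j → φ (μ m n) ∈ S)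
    {w : W} (hw : w ∈ 𝒲 r) : φ w ∈ S := by
  refine (Submodule.span_le (p := S.comap φ)).2 ?_ (h.span r hw)
  rintro _ ⟨i, j, m, n, hij, hm, hn, rfl⟩
  exact H i j m n hij hm hn

lemma eq_of_mem (h : RealizesGradedTensor k M N W 𝒱M 𝒱N 𝒲 μ) (φ ψ : W →ₗ[k] V) {r : ℤ}
    (H : ∀ i j m n, i + j = r → m ∈ 𝒱M i → n ∈ 𝒱N j → φ (μ m n) = ψ (μ m n))
    {w : W} (hw : w ∈ 𝒲 r) : φ w = ψ w := by
  have := h.mem_of_forall (φ - ψ) ⊥ (fun i j m n hij hm hn => by simp [H i j m n hij hm hn]) hw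
  simpa [sub_eq_zero] using this

/-- Two bilinear maps agree on homogeneous elements if they agree on homogeneous tensors. -/
lemma eq_of_mem₂ (h : RealizesGradedTensor k M N W 𝒱M 𝒱N 𝒲 μ)
    (φ ψ : W →ₗ[k] W →ₗ[k] V) {r s : ℤ}
    (H : ∀ i₁ j₁ i₂ j₂ m₁ n₁ m₂ n₂, i₁ + j₁ = r → i₂ + j₂ = s →
      m₁ ∈ 𝒱M i₁ → n₁ ∈ 𝒱N j₁ → m₂ ∈ 𝒱M i₂ → n₂ ∈ 𝒱N j₂ →
      φ (μ m₁ n₁) (μ m₂ n₂) = ψ (μ m₁ n₁) (μ m₂ n₂))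
    {x y : W} (hx : x ∈ 𝒲 r) (hy : y ∈ 𝒲 s) : φ x y = ψ x y := by
  refine h.eq_of_mem (φ x) (ψ x) (fun i₂ j₂ m₂ n₂ hs hm₂ hn₂ => ?_) hy
  exact h.eq_of_mem (φ.flip (μ m₂ n₂)) (ψ.flip (μ m₂ n₂))
    (fun i₁ j₁ m₁ n₁ hr hm₁ hn₁ => H i₁ j₁ i₂ j₂ m₁ n₁ m₂ n₂ hr hs hm₁ hn₁ hm₂ hn₂) hx

end RealizesGradedTensor

namespace RealizesGradedTensorAlg

variable {k : Type} [Field k]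
  {A : Type} [Ring A] [Algebra k A] {B : Type} [Ring B] [Algebra k B]
  {C : Type} [Ring C] [Algebra k C] {V : Type} [AddCommGroup V] [Module k V]
  {𝒜 : ℤ → Submodule k A} {ℬ : ℤ → Submodule k B} {𝒞 : ℤ → Submodule k C}
  {μ : A →ₗ[k] B →ₗ[k] C}

lemma linearMap_ext [GradedAlgebra 𝒜] [GradedAlgebra ℬ]
    (h : RealizesGradedTensorAlg k A B C 𝒜 ℬ 𝒞 μ) {φ ψ : C →ₗ[k] V}
    (H : ∀ i j a b, a ∈ 𝒜 i → b ∈ ℬ j → φ (μ a b) = ψ (μ a b)) : φ = ψ := by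
  have key : ∀ a b, φ (μ a b) = ψ (μ a b) := by
    intro a b
    induction a using DirectSum.Decomposition.inductionOn 𝒜 with
    | zero => simp
    | add a a' ha ha' => simp [ha, ha']
    | homogeneous a =>
      induction b using DirectSum.Decomposition.inductionOn ℬ with
      | zero => simp
      | add b b' hb hb' => simp [hb, hb']
      | homogeneous b => exact H _ _ _ _ a.2 b.2
  ext w
  obtain ⟨t, rfl⟩ := h.toRealizesGradedTensor.bij.2 w
  induction t with
  | zero => simp
  | add x y hx hy => simp only [map_add, hx, hy]
  | tmul a b => simpa using key a b

end RealizesGradedTensorAlg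

namespace IsPTriple

variable {k : Type} [Field k] {A : Type} [Ring A] [Algebra k A] {C : Type} [Ring C] [Algebra k C]
  {𝒜 : ℤ → Submodule k A} {dA : A →ₗ[k] A} {br : A →ₗ[k] A →ₗ[k] A} {p : ℤ}
  {𝒞 : ℤ → Submodule k C} {dC : C →ₗ[k] C} {f g : A →ₗ[k] C}

lemma f_mul_f_swap (hA : IsDGPoissonAlgebra k A 𝒜 dA br p)
    (h : IsPTriple k A C 𝒜 dA br p 𝒞 dC f g) {i j : ℤ} {a b : A} (ha : a ∈ 𝒜 i) (hb : b ∈ 𝒜 j) :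
    f b * f a = ((-1 : k) ^ (i * j)) • (f a * f b) := by
  rw [← h.f_mul, hA.comm j i b a hb ha, map_smul, h.f_mul, mul_comm]

/-- The relation between the mixed products `g b f a` forced by antisymmetry of the bracket
together with (P3). -/
lemma g_mul_f_swap (hA : IsDGPoissonAlgebra k A 𝒜 dA br p)
    (h : IsPTriple k A C 𝒜 dA br p 𝒞 dC f g) {i j : ℤ} {a b : A} (ha : a ∈ 𝒜 i) (hb : b ∈ 𝒜 j) :
    g b * f a = ((-1 : k) ^ ((j + p) * i)) • (f a * g b) -
      ((-1 : k) ^ ((i + p) * (j + p))) •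
        (g a * f b - ((-1 : k) ^ ((i + p) * j)) • (f b * g a)) := by
  have h₁ := h.f_br j i b a hb ha
  rw [hA.antisymm j i b a hb ha, map_neg, map_smul, h.f_br i j a b ha hb] at h₁
  rw [mul_comm (i + p) (j + p), eq_add_of_sub_eq h₁.symm]
  abel

end IsPTriple

set_option maxHeartbeats 1000000 in
/-- **Lemma 4.4.**  Let `A`, `B` be DG Poisson algebras with brackets of the
same degree `p`, and let `(C, f, g)` and `(D, fD, gD)` be triples with property `𝒫` with
respect to `A` and `B`.  Then `(C ⊗ D, f ⊗ fD, f ⊗ gD + (-1)^{p|B|} g ⊗ fD)` is a triple with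
property `𝒫` with respect to the tensor product DG Poisson algebra `A ⊗ B`. -/
theorem tensor_pTriple
    (k : Type) [Field k]
    (A : Type) [Ring A] [Algebra k A]
    (𝒜 : ℤ → Submodule k A) [GradedAlgebra 𝒜] (dA : A →ₗ[k] A)
    (brA : A →ₗ[k] A →ₗ[k] A)
    (B : Type) [Ring B] [Algebra k B]
    (ℬ : ℤ → Submodule k B) [GradedAlgebra ℬ] (dB : B →ₗ[k] B)
    (brB : B →ₗ[k] B →ₗ[k] B) (p : ℤ)
    (hA : IsDGPoissonAlgebra k A 𝒜 dA brA p)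
    (hB : IsDGPoissonAlgebra k B ℬ dB brB p)
    -- a `𝒫`-triple `(C, f, g)` with respect to `A`
    (C : Type) [Ring C] [Algebra k C]
    (𝒞 : ℤ → Submodule k C) (dC : C →ₗ[k] C)
    (hC : IsDGAlgebra k C 𝒞 dC)
    (f g : A →ₗ[k] C)
    (hfg : IsPTriple k A C 𝒜 dA brA p 𝒞 dC f g)
    -- a `𝒫`-triple `(D, fD, gD)` with respect to `B`
    (D : Type) [Ring D] [Algebra k D]
    (𝒟 : ℤ → Submodule k D) (dD : D →ₗ[k] D)
    (hD : IsDGAlgebra k D 𝒟 dD)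
    (fD gD : B →ₗ[k] D)
    (hfgD : IsPTriple k B D ℬ dB brB p 𝒟 dD fD gD)
    -- `T` realizes the tensor product DG Poisson algebra `A ⊗ B`
    (T : Type) [Ring T] [Algebra k T]
    (𝒯 : ℤ → Submodule k T) (μT : A →ₗ[k] B →ₗ[k] T)
    (hT : RealizesGradedTensorAlg k A B T 𝒜 ℬ 𝒯 μT)
    (dT : T →ₗ[k] T)
    (hdT : ∀ (i j : ℤ) (a : A) (b : B), a ∈ 𝒜 i → b ∈ ℬ j →
      dT (μT a b) = μT (dA a) b + ((-1 : k) ^ i) • μT a (dB b))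
    (brT : T →ₗ[k] T →ₗ[k] T)
    (hbrT : ∀ (i₁ j₁ i₂ j₂ : ℤ) (a₁ a₂ : A) (b₁ b₂ : B),
      a₁ ∈ 𝒜 i₁ → b₁ ∈ ℬ j₁ → a₂ ∈ 𝒜 i₂ → b₂ ∈ ℬ j₂ →
      brT (μT a₁ b₁) (μT a₂ b₂) =
        ((-1 : k) ^ ((i₂ + p) * j₁)) • μT (brA a₁ a₂) (b₁ * b₂) +
        ((-1 : k) ^ ((j₁ + p) * i₂)) • μT (a₁ * a₂) (brB b₁ b₂))
    -- `E` realizes the graded tensor product DG algebra `C ⊗ D`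
    (E : Type) [Ring E] [Algebra k E]
    (ℰ : ℤ → Submodule k E) (ν : C →ₗ[k] D →ₗ[k] E)
    (hE : RealizesGradedTensorAlg k C D E 𝒞 𝒟 ℰ ν)
    (dE : E →ₗ[k] E)
    (hdE : ∀ (i j : ℤ) (c : C) (d : D), c ∈ 𝒞 i → d ∈ 𝒟 j →
      dE (ν c d) = ν (dC c) d + ((-1 : k) ^ i) • ν c (dD d)) :
    -- conclusion: `(C ⊗ D, f ⊗ fD, f ⊗ gD + (-1)^{p |B|} g ⊗ fD)` is a `𝒫`-triple w.r.t. `A ⊗ B`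
    ∃ F G : T →ₗ[k] E,
      (∀ (a : A) (b : B), F (μT a b) = ν (f a) (fD b)) ∧
      (∀ (j : ℤ) (b : B), b ∈ ℬ j → ∀ a : A,
        G (μT a b) = ν (f a) (gD b) + ((-1 : k) ^ (p * j)) • ν (g a) (fD b)) ∧
      IsPTriple k T E 𝒯 dT brT p ℰ dE F G := by
  have ht := hT.toRealizesGradedTensor
  obtain ⟨F, hF⟩ : ∃ F : T →ₗ[k] E, ∀ a b, F (μT a b) = ν (f a) (fD b) :=
    ⟨ht.desc (ν.compl₁₂ f fD), fun a b => by simp [ht.desc_apply]⟩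
  obtain ⟨G, hG⟩ : ∃ G : T →ₗ[k] E, ∀ (j : ℤ) (b : B), b ∈ ℬ j → ∀ a : A,
      G (μT a b) = ν (f a) (gD b) + ((-1 : k) ^ (p * j)) • ν (g a) (fD b) :=
    ⟨ht.desc (ν.compl₁₂ f gD + ν.compl₁₂ g (fD ∘ₗ gradedSign ℬ p)), fun j b hb a => by
      simp [ht.desc_apply, gradedSign_of_mem ℬ p hb]⟩
  have hmulA : ∀ {i j : ℤ} {a b : A}, a ∈ 𝒜 i → b ∈ 𝒜 j → a * b ∈ 𝒜 (i + j) :=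
    fun ha hb => SetLike.mul_mem_graded ha hb
  have hmulB : ∀ {i j : ℤ} {a b : B}, a ∈ ℬ i → b ∈ ℬ j → a * b ∈ ℬ (i + j) :=
    fun ha hb => SetLike.mul_mem_graded ha hb
  refine ⟨F, G, hF, hG, ?_, ?_, ?_, ?_, ?_, ?_, ?_, ?_, ?_⟩
  · rw [← hT.one, hF, hfg.f_one, hfgD.f_one, hE.one]
  · suffices h : (LinearMap.mul k T).compr₂ F = (LinearMap.mul k E).compl₁₂ F F by
      intro x y
      simpa using LinearMap.congr_fun₂ h x y
    refine hT.linearMap_ext fun i₁ j₁ a₁ b₁ ha₁ hb₁ =>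
      hT.linearMap_ext fun i₂ j₂ a₂ b₂ ha₂ hb₂ => ?_
    simp only [LinearMap.compr₂_apply, LinearMap.mul_apply', LinearMap.compl₁₂_apply]
    rw [hT.mul _ _ _ _ _ _ _ _ ha₁ hb₁ ha₂ hb₂, map_smul, hF, hF, hF,
      hE.mul _ _ _ _ _ _ _ _ (hfg.f_mem _ _ ha₁) (hfgD.f_mem _ _ hb₁) (hfg.f_mem _ _ ha₂)
        (hfgD.f_mem _ _ hb₂), hfg.f_mul, hfgD.f_mul]
  · intro r x hx
    refine ht.mem_of_forall F (ℰ r) (fun i j a b hr ha hb => ?_) hx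
    rw [hF, ← hr]
    exact hE.toRealizesGradedTensor.mem _ _ _ _ (hfg.f_mem _ _ ha) (hfgD.f_mem _ _ hb)
  · suffices h : F ∘ₗ dT = dE ∘ₗ F from LinearMap.congr_fun h
    refine hT.linearMap_ext fun i j a b ha hb => ?_
    simp only [LinearMap.comp_apply]
    rw [hdT i j a b ha hb, hF, hdE i j _ _ (hfg.f_mem _ _ ha) (hfgD.f_mem _ _ hb), map_add,
      map_smul, hF, hF, hfg.f_d, hfgD.f_d]
  · intro r x hx
    refine ht.mem_of_forall G (ℰ (r + p)) (fun i j a b hr ha hb => ?_) hx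
    rw [hG j b hb]
    refine add_mem ?_ (Submodule.smul_mem _ _ ?_)
    · convert hE.toRealizesGradedTensor.mem _ _ _ _ (hfg.f_mem _ _ ha) (hfgD.g_mem _ _ hb) using 2
      lia
    · convert hE.toRealizesGradedTensor.mem _ _ _ _ (hfg.g_mem _ _ ha) (hfgD.f_mem _ _ hb) using 2
      lia
  · suffices h : G ∘ₗ dT = dE ∘ₗ G from LinearMap.congr_fun h
    refine hT.linearMap_ext fun i j a b ha hb => ?_
    simp only [LinearMap.comp_apply]
    rw [hdT i j a b ha hb, hG j b hb, map_add, map_add, map_smul, map_smul, hG j b hb,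
      hG (j + 1) _ (hB.d_mem _ _ hb), hdE i _ _ _ (hfg.f_mem _ _ ha) (hfgD.g_mem _ _ hb),
      hdE _ j _ _ (hfg.g_mem _ _ ha) (hfgD.f_mem _ _ hb), hfg.f_d, hfg.g_d, hfgD.f_d, hfgD.g_d]
    simp only [mul_add, mul_one, neg_one_zpow_add]
    module
  · intro r s x y hx hy
    suffices h : brT.compr₂ G x y = ((LinearMap.mul k E).compl₁₂ G G -
        ((-1 : k) ^ ((r + p) * (s + p))) • ((LinearMap.mul k E).compl₁₂ G G).flip) x y by
      simpa using h
    refine ht.eq_of_mem₂ _ _ (fun i₁ j₁ i₂ j₂ a₁ b₁ a₂ b₂ hr hs ha₁ hb₁ ha₂ hb₂ => ?_) hx hy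
    subst hr hs
    have hf₁ := hfg.f_mem _ _ ha₁
    have hf₂ := hfg.f_mem _ _ ha₂
    have hg₁ := hfg.g_mem _ _ ha₁
    have hg₂ := hfg.g_mem _ _ ha₂
    have hf₁' := hfgD.f_mem _ _ hb₁
    have hf₂' := hfgD.f_mem _ _ hb₂
    have hg₁' := hfgD.g_mem _ _ hb₁
    have hg₂' := hfgD.g_mem _ _ hb₂
    simp only [LinearMap.compr₂_apply, LinearMap.mul_apply', LinearMap.compl₁₂_apply,
      LinearMap.sub_apply, LinearMap.smul_apply, LinearMap.flip_apply]
    rw [hbrT _ _ _ _ _ _ _ _ ha₁ hb₁ ha₂ hb₂, map_add, map_smul, map_smul,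
      hG _ _ (hmulB hb₁ hb₂), hG _ _ (hB.br_mem _ _ _ _ hb₁ hb₂), hG _ _ hb₁, hG _ _ hb₂,
      hfg.f_br _ _ _ _ ha₁ ha₂, hfg.g_br _ _ _ _ ha₁ ha₂, hfg.f_mul, hfg.g_mul _ _ _ _ ha₁ ha₂,
      hfgD.f_br _ _ _ _ hb₁ hb₂, hfgD.g_br _ _ _ _ hb₁ hb₂, hfgD.f_mul,
      hfgD.g_mul _ _ _ _ hb₁ hb₂]
    simp only [mul_add, add_mul, smul_mul_assoc, mul_smul_comm]
    rw [hE.mul _ _ _ _ _ _ _ _ hf₁ hg₁' hf₂ hg₂', hE.mul _ _ _ _ _ _ _ _ hf₁ hg₁' hg₂ hf₂',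
      hE.mul _ _ _ _ _ _ _ _ hg₁ hf₁' hf₂ hg₂', hE.mul _ _ _ _ _ _ _ _ hg₁ hf₁' hg₂ hf₂',
      hE.mul _ _ _ _ _ _ _ _ hf₂ hg₂' hf₁ hg₁', hE.mul _ _ _ _ _ _ _ _ hf₂ hg₂' hg₁ hf₁',
      hE.mul _ _ _ _ _ _ _ _ hg₂ hf₂' hf₁ hg₁', hE.mul _ _ _ _ _ _ _ _ hg₂ hf₂' hg₁ hf₁',
      hfg.f_mul_f_swap hA ha₁ ha₂, hfgD.f_mul_f_swap hB hb₁ hb₂,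
      hfg.g_mul_f_swap hA ha₁ ha₂, hfgD.g_mul_f_swap hB hb₁ hb₂]
    simp only [map_add, map_sub, map_smul, LinearMap.add_apply, LinearMap.sub_apply,
      LinearMap.smul_apply]
    simp only [mul_add, add_mul, neg_one_zpow_add, neg_one_zpow_self_mul, mul_comm p i₁,
      mul_comm p i₂, mul_comm p j₁, mul_comm p j₂, mul_comm j₁ i₂, mul_comm i₂ i₁,
      mul_comm j₂ j₁]
    match_scalars <;> grind [neg_one_zpow_mul_self]
  · intro r s x y hx hy
    suffices h : brT.compr₂ F x y = ((LinearMap.mul k E).compl₁₂ G F -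
        ((-1 : k) ^ ((r + p) * s)) • ((LinearMap.mul k E).compl₁₂ F G).flip) x y by
      simpa using h
    refine ht.eq_of_mem₂ _ _ (fun i₁ j₁ i₂ j₂ a₁ b₁ a₂ b₂ hr hs ha₁ hb₁ ha₂ hb₂ => ?_) hx hy
    subst hr hs
    have hf₁ := hfg.f_mem _ _ ha₁
    have hf₂ := hfg.f_mem _ _ ha₂
    have hg₁ := hfg.g_mem _ _ ha₁
    have hf₁' := hfgD.f_mem _ _ hb₁
    have hf₂' := hfgD.f_mem _ _ hb₂
    have hg₁' := hfgD.g_mem _ _ hb₁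
    simp only [LinearMap.compr₂_apply, LinearMap.mul_apply', LinearMap.compl₁₂_apply,
      LinearMap.sub_apply, LinearMap.smul_apply, LinearMap.flip_apply]
    rw [hbrT _ _ _ _ _ _ _ _ ha₁ hb₁ ha₂ hb₂, map_add, map_smul, map_smul, hF, hF, hF,
      hG _ _ hb₁, hfg.f_br _ _ _ _ ha₁ ha₂, hfg.f_mul, hfgD.f_br _ _ _ _ hb₁ hb₂, hfgD.f_mul]
    simp only [mul_add, add_mul, smul_mul_assoc, mul_smul_comm]
    rw [hE.mul _ _ _ _ _ _ _ _ hf₁ hg₁' hf₂ hf₂', hE.mul _ _ _ _ _ _ _ _ hg₁ hf₁' hf₂ hf₂',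
      hE.mul _ _ _ _ _ _ _ _ hf₂ hf₂' hf₁ hg₁', hE.mul _ _ _ _ _ _ _ _ hf₂ hf₂' hg₁ hf₁',
      hfg.f_mul_f_swap hA ha₁ ha₂, hfgD.f_mul_f_swap hB hb₁ hb₂]
    simp only [map_sub, map_smul, LinearMap.sub_apply, LinearMap.smul_apply]
    simp only [mul_add, add_mul, neg_one_zpow_add, mul_comm p i₂, mul_comm p j₁, mul_comm p j₂,
      mul_comm j₁ i₂]
    match_scalars <;> grind [neg_one_zpow_mul_self]
  · intro r s x y hx hy
    suffices h : (LinearMap.mul k T).compr₂ G x y = ((LinearMap.mul k E).compl₁₂ F G +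
        ((-1 : k) ^ (r * s)) • ((LinearMap.mul k E).compl₁₂ F G).flip) x y by
      simpa using h
    refine ht.eq_of_mem₂ _ _ (fun i₁ j₁ i₂ j₂ a₁ b₁ a₂ b₂ hr hs ha₁ hb₁ ha₂ hb₂ => ?_) hx hy
    subst hr hs
    have hf₁ := hfg.f_mem _ _ ha₁
    have hf₂ := hfg.f_mem _ _ ha₂
    have hg₁ := hfg.g_mem _ _ ha₁
    have hg₂ := hfg.g_mem _ _ ha₂
    have hf₁' := hfgD.f_mem _ _ hb₁
    have hf₂' := hfgD.f_mem _ _ hb₂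
    have hg₁' := hfgD.g_mem _ _ hb₁
    have hg₂' := hfgD.g_mem _ _ hb₂
    simp only [LinearMap.compr₂_apply, LinearMap.mul_apply', LinearMap.compl₁₂_apply,
      LinearMap.add_apply, LinearMap.smul_apply, LinearMap.flip_apply]
    rw [hT.mul _ _ _ _ _ _ _ _ ha₁ hb₁ ha₂ hb₂, map_smul, hF, hF, hG _ _ (hmulB hb₁ hb₂),
      hG _ _ hb₁, hG _ _ hb₂, hfg.f_mul, hfg.g_mul _ _ _ _ ha₁ ha₂, hfgD.f_mul,
      hfgD.g_mul _ _ _ _ hb₁ hb₂]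
    simp only [mul_add, mul_smul_comm]
    rw [hE.mul _ _ _ _ _ _ _ _ hf₁ hf₁' hf₂ hg₂', hE.mul _ _ _ _ _ _ _ _ hf₁ hf₁' hg₂ hf₂',
      hE.mul _ _ _ _ _ _ _ _ hf₂ hf₂' hf₁ hg₁', hE.mul _ _ _ _ _ _ _ _ hf₂ hf₂' hg₁ hf₁',
      hfg.f_mul_f_swap hA ha₁ ha₂, hfgD.f_mul_f_swap hB hb₁ hb₂]
    simp only [map_add, map_smul, LinearMap.add_apply, LinearMap.smul_apply]
    simp only [add_mul, neg_one_zpow_add, mul_comm p j₁, mul_comm p j₂, mul_comm j₁ i₂]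
    match_scalars <;> grind [neg_one_zpow_mul_self]

end
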